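/- arXiv:2003.09381 — 2 statements merged into one kernel-verified Lean document; each statement's English description precedes it below -/
import Mathlib

section
/- For all indices i, j with b ≤ i < n and n − b ≤ j < n (i.e., (i,j) lies in the bottom-right block Q₄ of Q_P), the minor μ(i, j) of Q_P equals 0. -/
open MvPolynomial Matrix

noncomputable section

/-- The scalar sequence `u`: first `n = m*b` values are `0,…,0,1`, then it follows the
linear recurrence with coefficients `c`. -/
def uSeq (m b : ℕ) (c : Fin (m*b) → ZMod 2) : ℕ → ZMod 2
  | s =>
    if s < m*b then (if s = m*b - 1 then 1 else 0)
    else ∑ j : Fin (m*b), c j * uSeq m b c (s - m*b + j)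
  termination_by s => s
  decreasing_by have := j.isLt; omega

/-- The symbolic sequence `w t`: first `n = m*b` values are the indeterminates `X (t, s)`,
then it follows the linear recurrence with coefficients `c`. -/
def wPoly (m b : ℕ) (c : Fin (m*b) → ZMod 2) (t : Fin (m-1)) :
    ℕ → MvPolynomial ((Fin (m-1)) × ℕ) (ZMod 2)
  | s =>
    if s < m*b then X (t, s)
    else ∑ j : Fin (m*b), C (c j) * wPoly m b c t (s - m*b + j)
  termination_by s => s
  decreasing_by have := j.isLt; omega

/-- The matrix `Q_P` of Equation (13). -/
def QP (m b : ℕ) (hm : 2 ≤ m) (hb : 1 ≤ b) (c : Fin (m*b) → ZMod 2) :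
    Matrix (Fin (m*b)) (Fin (m*b)) (MvPolynomial ((Fin (m-1)) × ℕ) (ZMod 2)) :=
  fun i j =>
    if (i : ℕ) < b then C (uSeq m b c ((i : ℕ) + (j : ℕ)))
    else wPoly m b c
      ⟨((i : ℕ) - b) / b, by
        have hi := i.isLt
        have h2 : 2 * b ≤ m * b := Nat.mul_le_mul hm (le_refl b)
        have h1 : b * (m - 1) = m * b - b := by
          cases m with
          | zero => simp
          | succ m' => simp [Nat.succ_mul, Nat.mul_comm]
        have : (i : ℕ) - b < b * (m - 1) := by omega
        exact Nat.div_lt_of_lt_mul this⟩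
      (((i : ℕ) - b) % b + (j : ℕ))

/-- The map from `Fin (n-1)` to `Fin n` skipping the index `i`. -/
def skipIdx {n : ℕ} (i : Fin n) (k : Fin (n - 1)) : Fin n :=
  if (k : ℕ) < (i : ℕ) then ⟨k, by have := k.isLt; have := i.isLt; omega⟩
  else ⟨(k : ℕ) + 1, by have := k.isLt; have := i.isLt; omega⟩

/-- The minor `μ(i,j)`: determinant of the matrix obtained by deleting row `i` and
column `j`. -/
def minorQ {n : ℕ} {R : Type*} [CommRing R] (A : Matrix (Fin n) (Fin n) R) (i j : Fin n) : R :=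
  (A.submatrix (skipIdx i) (skipIdx j)).det

/-- The bottom-left block `Q₃` of `Q_P`: rows `b,…,n-1` and columns `0,…,n-b-1`. -/
def Q3 (m b : ℕ) (hm : 2 ≤ m) (hb : 1 ≤ b) (c : Fin (m*b) → ZMod 2) :
    Matrix (Fin (m*b - b)) (Fin (m*b - b)) (MvPolynomial ((Fin (m-1)) × ℕ) (ZMod 2)) :=
  fun i j =>
    QP m b hm hb c
      ⟨b + (i : ℕ), by have := i.isLt; omega⟩
      ⟨(j : ℕ), by have := j.isLt; omega⟩

end

/-- If the rows in `S` are supported on the columns in `T` and `#T < #S`, the determinant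
vanishes. -/
theorem det_eq_zero_of_rows_supported_on_fewer_columns {ι R : Type*} [Fintype ι] [DecidableEq ι]
    [CommRing R] (M : Matrix ι ι R) (S T : Finset ι) (hcard : T.card < S.card)
    (hM : ∀ r ∈ S, ∀ k ∉ T, M r k = 0) : M.det = 0 := by
  rw [← det_transpose, det_apply]
  refine Finset.sum_eq_zero fun σ _ => ?_
  obtain ⟨r, hr, hσ⟩ : ∃ r ∈ S, σ r ∉ T := by
    by_contra! h
    exact hcard.not_ge (Finset.card_le_card_of_injOn σ h σ.injective.injOn)
  rw [Finset.prod_eq_zero (Finset.mem_univ r), smul_zero]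
  exact hM r hr _ hσ

theorem skipIdx_val_of_lt {n : ℕ} {i : Fin n} {k : Fin (n - 1)} (h : (k : ℕ) < i) :
    (skipIdx i k : ℕ) = k := by
  simp [skipIdx, h]

theorem uSeq_eq_zero {m b : ℕ} (c : Fin (m*b) → ZMod 2) {s : ℕ} (h : s + 1 < m*b) :
    uSeq m b c s = 0 := by
  rw [uSeq, if_pos (by omega), if_neg (by omega)]

theorem QP_eq_zero {m b : ℕ} (hm : 2 ≤ m) (hb : 1 ≤ b) (c : Fin (m*b) → ZMod 2)
    {r k : Fin (m*b)} (hr : (r : ℕ) < b) (hk : (r : ℕ) + k + 1 < m*b) :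
    QP m b hm hb c r k = 0 := by
  rw [QP, if_pos hr, uSeq_eq_zero c hk, map_zero]

/-- For `b ≤ i < n` and `n - b ≤ j < n` (the bottom-right block `Q₄`),
the minor `μ(i,j)` of `Q_P` equals `0`. -/
theorem minor_Q4_block_eq_zero
    (m b : ℕ) (hm : 2 ≤ m) (hb : 1 ≤ b) (c : Fin (m*b) → ZMod 2)
    (i j : Fin (m*b)) (hi : b ≤ (i : ℕ)) (hj : m*b - b ≤ (j : ℕ)) :
    minorQ (QP m b hm hb c) i j = 0 := by
  have hn : 2 * b ≤ m * b := Nat.mul_le_mul_right b hm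
  refine det_eq_zero_of_rows_supported_on_fewer_columns _
    (Finset.univ.filter fun k => (k : ℕ) < b)
    (Finset.univ.filter fun k => (k : ℕ) < m*b - b)ᶜ ?_ fun r hr k hk => ?_
  · rw [Finset.card_compl, Fin.card_filter_val_lt, Fin.card_filter_val_lt, Fintype.card_fin]
    omega
  · simp only [Finset.mem_compl, Finset.mem_filter, Finset.mem_univ, true_and, not_not] at hr hk
    have hr' : (skipIdx i r : ℕ) = r := skipIdx_val_of_lt (by omega)
    have hk' : (skipIdx j k : ℕ) = k := skipIdx_val_of_lt (by omega)
    exact QP_eq_zero hm hb c (by omega) (by omega)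
end

section
/- The maximum, over all pairs of indices (i, j), of the total degree of the (i,j) entry of the adjugate matrix of Q_P equals n − b; that is, every entry of adjugate(Q_P) has total degree at most n − b and some entry has total degree exactly n − b. -/
open MvPolynomial Matrix

theorem det_isHomogeneous {σ R ι : Type*} [CommRing R] [Fintype ι] [DecidableEq ι]
    {A : Matrix ι ι (MvPolynomial σ R)} {d : ι → ℕ}
    (hA : ∀ i j, (A i j).IsHomogeneous (d i)) : A.det.IsHomogeneous (∑ i, d i) := by
  rw [← det_transpose, det_apply]
  refine IsHomogeneous.sum _ _ _ fun e _ => ?_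
  rw [Units.smul_def, ← mem_homogeneousSubmodule]
  exact zsmul_mem (IsHomogeneous.prod _ _ _ fun i _ => hA i (e i)) _

theorem adjugate_isHomogeneous {σ R ι : Type*} [CommRing R] [Fintype ι] [DecidableEq ι]
    {A : Matrix ι ι (MvPolynomial σ R)} {d : ι → ℕ}
    (hA : ∀ i j, (A i j).IsHomogeneous (d i)) (i j : ι) :
    (A.adjugate i j).IsHomogeneous (∑ k, Function.update d j 0 k) := by
  rw [adjugate_apply]
  refine det_isHomogeneous fun k l => ?_
  obtain rfl | hk := eq_or_ne k j
  · obtain rfl | hl := eq_or_ne l i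
    · simpa using isHomogeneous_one σ R
    · simpa [hl] using isHomogeneous_zero σ R 0
  · simpa [hk] using hA k l

theorem det_ne_zero_of_antitriangular {R : Type*} [CommRing R] [Nontrivial R] {n : ℕ}
    {A : Matrix (Fin n) (Fin n) R} (h0 : ∀ i j : Fin n, (i : ℕ) + j < n - 1 → A i j = 0)
    (h1 : ∀ i j : Fin n, (i : ℕ) + j = n - 1 → A i j = 1) : A.det ≠ 0 := by
  intro hA
  have hrev := det_permute' Fin.revPerm A
  rw [hA, mul_zero, det_of_isLowerTriangular] at hrev
  · rw [Finset.prod_eq_one] at hrev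
    · exact one_ne_zero hrev
    · intro i _
      exact h1 _ _ (by simp [Fin.val_rev]; omega)
  · intro i j hij
    have hij : (i : ℕ) < j := hij
    exact h0 _ _ (by simp [Fin.val_rev]; omega)

theorem wPoly_isHomogeneous (m b : ℕ) (c : Fin (m*b) → ZMod 2) (t : Fin (m-1)) (s : ℕ) :
    (wPoly m b c t s).IsHomogeneous 1 := by
  induction s using Nat.strong_induction_on with
  | _ s ih =>
    rw [wPoly]
    split_ifs with hs
    · exact isHomogeneous_X _ _
    · refine IsHomogeneous.sum _ _ _ fun j _ => ?_
      have hj := j.isLt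
      simpa using (isHomogeneous_C _ (c j)).mul (ih (s - m*b + j) (by omega))

theorem QP_isHomogeneous (m b : ℕ) (hm : 2 ≤ m) (hb : 1 ≤ b) (c : Fin (m*b) → ZMod 2)
    (i j : Fin (m*b)) :
    (QP m b hm hb c i j).IsHomogeneous (if (i : ℕ) < b then 0 else 1) := by
  unfold QP
  split_ifs
  · exact isHomogeneous_C _ _
  · exact wPoly_isHomogeneous ..

/-- Specializing each `v_t` to the standard basis vector with index `n - 1 - (t + 1) * b` makes
`Q_P` triangular with respect to the antidiagonal. -/
theorem QP_det_ne_zero (m b : ℕ) (hm : 2 ≤ m) (hb : 1 ≤ b) (c : Fin (m*b) → ZMod 2) :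
    (QP m b hm hb c).det ≠ 0 := by
  let f : MvPolynomial (Fin (m-1) × ℕ) (ZMod 2) →+* ZMod 2 :=
    eval fun p => if p.2 + (p.1 + 1) * b = m*b - 1 then 1 else 0
  have hf : ∀ i j : Fin (m*b), (i : ℕ) + j ≤ m*b - 1 →
      f (QP m b hm hb c i j) = if (i : ℕ) + j = m*b - 1 then 1 else 0 := by
    intro i j hij
    have hi := i.isLt
    unfold QP
    split_ifs with hib h h
    · rw [uSeq, if_pos (by omega), if_pos h]; simp
    · rw [uSeq, if_pos (by omega), if_neg h]; simp
    all_goals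
      have hdiv := Nat.mod_add_div ((i : ℕ) - b) b
      have hmod := Nat.mod_le ((i : ℕ) - b) b
      have hidx : ((i : ℕ) - b) % b + j + (((i : ℕ) - b) / b + 1) * b = i + j := by
        rw [add_mul, mul_comm (_ / b)]; omega
      rw [wPoly, if_pos (by omega)]
      simp [f, hidx, h]
  intro hdet
  have hmap : (f.mapMatrix (QP m b hm hb c)).det = 0 := by
    rw [← RingHom.map_det, hdet, map_zero]
  refine det_ne_zero_of_antitriangular (fun i j hij => ?_) (fun i j hij => ?_) hmap
  · exact (hf i j hij.le).trans (if_neg hij.ne)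
  · exact (hf i j hij.le).trans (if_pos hij)

theorem sum_ite_val_lt (n b : ℕ) (hbn : b ≤ n) :
    ∑ k : Fin n, (if (k : ℕ) < b then 0 else 1) = n - b := by
  rw [Fin.sum_univ_eq_sum_range (fun k => if k < b then 0 else 1),
    ← Finset.sum_range_add_sum_Ico _ hbn, Finset.sum_eq_zero, Finset.sum_congr rfl
      (g := fun _ => 1)]
  · simp
  · intro k hk
    rw [Finset.mem_Ico] at hk
    exact if_neg (by omega)
  · intro k hk
    exact if_pos (Finset.mem_range.1 hk)

/-- The maximum over all `(i,j)` of the total degree of the `(i,j)` entry of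
`adjugate Q_P` equals `n - b`: every entry has total degree at most `n - b` and some entry
has total degree exactly `n - b`. -/
theorem adjugate_QP_max_totalDegree
    (m b : ℕ) (hm : 2 ≤ m) (hb : 1 ≤ b) (c : Fin (m*b) → ZMod 2) :
    (∀ i j : Fin (m*b), ((QP m b hm hb c).adjugate i j).totalDegree ≤ m*b - b) ∧
    (∃ i j : Fin (m*b), ((QP m b hm hb c).adjugate i j).totalDegree = m*b - b) := by
  have hbn : b ≤ m*b := Nat.le_mul_of_pos_left b (by omega)
  have hadj := adjugate_isHomogeneous (QP_isHomogeneous m b hm hb c)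
  constructor
  · intro i j
    refine (hadj i j).totalDegree_le.trans ?_
    rw [← sum_ite_val_lt _ _ hbn]
    refine Finset.sum_le_sum fun k _ => ?_
    obtain rfl | hk := eq_or_ne k j
    · simp
    · simp [hk]
  · let z : Fin (m*b) := ⟨0, by omega⟩
    have hz : ∃ i, (QP m b hm hb c).adjugate i z ≠ 0 := by
      by_contra! h
      apply QP_det_ne_zero m b hm hb c
      have := congrFun (congrFun (mul_adjugate (QP m b hm hb c)) z) z
      simpa [mul_apply, h] using this.symm
    obtain ⟨i, hi⟩ := hz
    refine ⟨i, z, ((hadj i z).totalDegree hi).trans ?_⟩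
    rw [Function.update_eq_self_iff.2 (if_pos hb).symm, sum_ite_val_lt _ _ hbn]
end
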